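/- arXiv:2003.11592 — 6 statements merged into one kernel-verified Lean document; each statement's English description precedes it below -/
import Mathlib

section
/- Let K ⊆ L be an extension of fields and let v be a discrete valuation on L (a valuation with value group ℤ) whose restriction to K is nontrivial (i.e., there is a nonzero element of K with nonzero valuation). Let O_L ⊆ L be the valuation ring of v with residue field L_v, and let K_v be the residue field of the valuation ring of the restriction of v to K. Then the transcendence degree of L over K is at least the transcendence degree of L_v over K_v. -/
/-- The transcendence degree of a commutative `R`-algebra `A`: the supremum of the
cardinalities of algebraically independent subsets of `A` over `R`.  For a field
extension this is the cardinality of any transcendence basis. -/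
noncomputable def trdeg (R A : Type*) [CommRing R] [CommRing A] [Algebra R A] : Cardinal :=
  ⨆ s : { s : Set A // AlgebraicIndependent R ((↑) : s → A) }, Cardinal.mk s

/-- The ring homomorphism from the valuation ring of the restriction of `v` to the valuation
ring of `v`. -/
def Valuation.comapValuationSubringHom {K L Γ : Type*} [Field K] [Field L] [Algebra K L]
    [LinearOrderedCommGroupWithZero Γ] (v : Valuation L Γ) :
    (v.comap (algebraMap K L)).valuationSubring →+* v.valuationSubring :=
  ((algebraMap K L).comp (v.comap (algebraMap K L)).valuationSubring.subtype).codRestrict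
    v.valuationSubring fun x => x.2

/-- Every nonzero multivariate polynomial over a valued field has a nonzero scalar multiple with
coefficients in the valuation ring, one of them being `1`. -/
theorem Valuation.exists_map_subtype_eq_C_mul {K Γ σ : Type*} [Field K]
    [LinearOrderedCommGroupWithZero Γ] (w : Valuation K Γ) {P : MvPolynomial σ K} (hP : P ≠ 0) :
    ∃ (c : K) (Q : MvPolynomial σ w.valuationSubring) (m : σ →₀ ℕ),
      MvPolynomial.map w.valuationSubring.subtype Q = MvPolynomial.C c * P ∧ Q.coeff m = 1 := by
  obtain ⟨m, hm, hmax⟩ := Finset.exists_max_image P.support (fun m => w (P.coeff m))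
    (MvPolynomial.support_nonempty.mpr hP)
  have hm0 : P.coeff m ≠ 0 := MvPolynomial.mem_support_iff.mp hm
  have hmem : MvPolynomial.C (P.coeff m)⁻¹ * P ∈
      Set.range (MvPolynomial.map (σ := σ) w.valuationSubring.subtype) := by
    rw [MvPolynomial.mem_range_map_iff_coeffs_subset]
    intro a ha
    obtain ⟨n, -, rfl⟩ := MvPolynomial.mem_coeffs_iff.mp ha
    refine ⟨⟨MvPolynomial.coeff n (MvPolynomial.C (P.coeff m)⁻¹ * P), ?_⟩, rfl⟩
    rw [Valuation.mem_valuationSubring_iff, MvPolynomial.coeff_C_mul, map_mul, map_inv₀]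
    refine inv_mul_le_one_of_le₀ ?_ zero_le
    by_cases hn : n ∈ P.support
    · exact hmax n hn
    · simp [MvPolynomial.notMem_support_iff.mp hn]
  obtain ⟨Q, hQ⟩ := hmem
  refine ⟨_, Q, m, hQ, Subtype.ext ?_⟩
  have h := congrArg (MvPolynomial.coeff m) hQ
  rw [MvPolynomial.coeff_map, MvPolynomial.coeff_C_mul, inv_mul_cancel₀ hm0] at h
  exact h

/-- A family in the valuation ring whose residues are algebraically independent over the residue
field of the restricted valuation is algebraically independent over the base field. -/
theorem Valuation.algebraicIndependent_of_residue {K L Γ ι : Type*} [Field K] [Field L]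
    [Algebra K L] [LinearOrderedCommGroupWithZero Γ] (v : Valuation L Γ)
    [Algebra (IsLocalRing.ResidueField (v.comap (algebraMap K L)).valuationSubring)
      (IsLocalRing.ResidueField v.valuationSubring)]
    (hcomp : (algebraMap (IsLocalRing.ResidueField (v.comap (algebraMap K L)).valuationSubring)
        (IsLocalRing.ResidueField v.valuationSubring)).comp (IsLocalRing.residue _) =
      (IsLocalRing.residue _).comp v.comapValuationSubringHom)
    (g : ι → v.valuationSubring)
    (hg : AlgebraicIndependent
      (IsLocalRing.ResidueField (v.comap (algebraMap K L)).valuationSubring)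
      fun i => IsLocalRing.residue _ (g i)) :
    AlgebraicIndependent K fun i => (g i : L) := by
  rw [algebraicIndependent_iff]
  intro P hP
  by_contra hP0
  obtain ⟨c, Q, m, hQ, hm⟩ := (v.comap (algebraMap K L)).exists_map_subtype_eq_C_mul hP0
  have hL : MvPolynomial.eval₂ v.comapValuationSubringHom g Q = 0 := by
    have h : MvPolynomial.aeval (fun i => (g i : L)) (MvPolynomial.C c * P) = 0 := by
      rw [map_mul, hP, mul_zero]
    rw [← hQ, MvPolynomial.aeval_def, MvPolynomial.eval₂_map] at h
    refine Subtype.val_injective (Eq.trans ?_ h)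
    exact MvPolynomial.eval₂_comp_left v.valuationSubring.subtype v.comapValuationSubringHom g Q
  have hres : MvPolynomial.aeval (fun i => IsLocalRing.residue _ (g i))
      (MvPolynomial.map (IsLocalRing.residue _) Q) = 0 := by
    rw [MvPolynomial.aeval_def, MvPolynomial.eval₂_map, hcomp]
    exact (MvPolynomial.eval₂_comp_left (IsLocalRing.residue v.valuationSubring)
      v.comapValuationSubringHom g Q).symm.trans (by rw [hL, map_zero])
  have h := congrArg (MvPolynomial.coeff m) (algebraicIndependent_iff.mp hg _ hres)
  rw [MvPolynomial.coeff_map, hm, map_one, MvPolynomial.coeff_zero] at h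
  exact one_ne_zero h

/-- Let `K ⊆ L` be a field extension and `v` a discrete valuation on `L` (written
multiplicatively, with value group `ℤ`, i.e. `v` is surjective onto
`WithZero (Multiplicative ℤ)`), whose restriction to `K` is nontrivial.  Let `O_L` be the
valuation ring of `v` with residue field `L_v`, and `K_v` the residue field of the valuation
ring of the restriction of `v` to `K`.  Then `trdeg_{K_v} L_v ≤ trdeg_K L`, where `L_v` is
viewed as a `K_v`-algebra via the natural map `f` between the residue fields. -/
theorem stmt0 (K L : Type*) [Field K] [Field L] [Algebra K L]
    (v : Valuation L (WithZero (Multiplicative ℤ)))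
    (hsurj : Function.Surjective v)
    (hnontriv : ∃ x : K, x ≠ 0 ∧ v (algebraMap K L x) ≠ 1)
    (f : IsLocalRing.ResidueField ((v.comap (algebraMap K L)).valuationSubring) →+*
      IsLocalRing.ResidueField (v.valuationSubring))
    (hf : ∀ (x : (v.comap (algebraMap K L)).valuationSubring)
      (hx : algebraMap K L (x : K) ∈ v.valuationSubring),
      f (IsLocalRing.residue _ x) =
        IsLocalRing.residue _ (⟨algebraMap K L (x : K), hx⟩ : v.valuationSubring)) :
    @trdeg (IsLocalRing.ResidueField ((v.comap (algebraMap K L)).valuationSubring))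
        (IsLocalRing.ResidueField (v.valuationSubring)) _ _ f.toAlgebra ≤
      trdeg K L := by
  let := f.toAlgebra
  refine ciSup_le' fun s => ?_
  choose g hg using fun i : s.1 => IsLocalRing.residue_surjective (i : IsLocalRing.ResidueField
    v.valuationSubring)
  have hind : AlgebraicIndependent K fun i => (g i : L) := by
    refine v.algebraicIndependent_of_residue (RingHom.ext fun x => hf x x.2) g ?_
    simpa only [hg] using s.2
  rw [← Cardinal.mk_range_eq _ hind.injective]
  exact le_ciSup (f := fun t : { t : Set L // AlgebraicIndependent K ((↑) : t → L) } =>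
    Cardinal.mk t) Cardinal.bddAbove_of_small ⟨_, hind.coe_range⟩
end

section
/- Let K ⊆ L be an extension of fields and let v be a discrete valuation on L whose restriction to K is nontrivial. Let O_L be the valuation ring of v, L_v its residue field, and K_v the residue field of the valuation ring O_K = O_L ∩ K of the restriction of v to K. If x_1, …, x_m ∈ O_L are elements whose images x̄_1, …, x̄_m in the residue field L_v are algebraically independent over K_v, then x_1, …, x_m are algebraically independent over K. -/
open MvPolynomial in
/-- A nonzero polynomial over a valued field can be rescaled to have coefficients in the valuation
ring and nonzero reduction modulo the maximal ideal. -/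
theorem exists_rescale_map_residue_ne_zero {σ K Γ : Type*} [Field K]
    [LinearOrderedCommGroupWithZero Γ] (w : Valuation K Γ) {p : MvPolynomial σ K} (hp : p ≠ 0) :
    ∃ (c : K) (q : MvPolynomial σ w.valuationSubring),
      map w.valuationSubring.subtype q = C c * p ∧
        map (IsLocalRing.residue w.valuationSubring) q ≠ 0 := by
  obtain ⟨d, hd, hmax⟩ := p.support.exists_max_image (fun e => w (p.coeff e))
    (support_nonempty.mpr hp)
  have hd0 : p.coeff d ≠ 0 := mem_support_iff.mp hd
  have hint (e : σ →₀ ℕ) : (p.coeff d)⁻¹ * p.coeff e ∈ w.valuationSubring := by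
    rw [Valuation.mem_valuationSubring_iff, map_mul, map_inv₀]
    by_cases he : p.coeff e = 0
    · simp [he]
    · exact inv_mul_le_one_of_le₀ (hmax e (mem_support_iff.mpr he)) zero_le
  obtain ⟨q, hq⟩ : C (p.coeff d)⁻¹ * p ∈ Set.range (map (σ := σ) w.valuationSubring.subtype) := by
    refine mem_range_map_iff_coeffs_subset.mpr fun a ha => ?_
    obtain ⟨e, -, rfl⟩ := mem_coeffs_iff.mp ha
    rw [coeff_C_mul]
    exact ⟨⟨_, hint e⟩, rfl⟩
  refine ⟨_, q, hq, fun h0 => ?_⟩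
  have hone : q.coeff d = 1 := by
    apply Subtype.ext
    simpa [coeff_map, coeff_C_mul, hd0] using congrArg (coeff d) hq
  simpa [coeff_map, hone] using congrArg (coeff d) h0

/-- Let `K ⊆ L` be a field extension and `v` a discrete valuation on `L` (written
multiplicatively, with value group `ℤ`, i.e. `v` is surjective onto
`WithZero (Multiplicative ℤ)`), whose restriction to `K` is nontrivial.  Let `O_L` be the
valuation ring of `v` with residue field `L_v`, and `K_v` the residue field of the valuation
ring `O_K = O_L ∩ K` of the restriction of `v` to `K`; `K_v` embeds into `L_v` via the
natural map `f`.  If `x 1, …, x m ∈ O_L` have residues in `L_v` that are algebraically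
independent over `K_v`, then `x 1, …, x m` are algebraically independent over `K`. -/
theorem stmt1 (K L : Type*) [Field K] [Field L] [Algebra K L]
    (v : Valuation L (WithZero (Multiplicative ℤ)))
    (hsurj : Function.Surjective v)
    (hnontriv : ∃ x : K, x ≠ 0 ∧ v (algebraMap K L x) ≠ 1)
    (f : IsLocalRing.ResidueField ((v.comap (algebraMap K L)).valuationSubring) →+*
      IsLocalRing.ResidueField (v.valuationSubring))
    (hf : ∀ (y : (v.comap (algebraMap K L)).valuationSubring)
      (hy : algebraMap K L (y : K) ∈ v.valuationSubring),
      f (IsLocalRing.residue _ y) =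
        IsLocalRing.residue _ (⟨algebraMap K L (y : K), hy⟩ : v.valuationSubring))
    (m : ℕ) (x : Fin m → v.valuationSubring)
    (hind : @AlgebraicIndependent (Fin m)
      (IsLocalRing.ResidueField ((v.comap (algebraMap K L)).valuationSubring))
      (IsLocalRing.ResidueField (v.valuationSubring))
      (fun i => IsLocalRing.residue _ (x i)) _ _ f.toAlgebra) :
    AlgebraicIndependent K (fun i => (x i : L)) := by
  let w := v.comap (algebraMap K L)
  let g : w.valuationSubring →+* v.valuationSubring :=
    ((algebraMap K L).comp w.valuationSubring.subtype).codRestrict v.valuationSubring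
      fun y => y.2
  have hfg : f.comp (IsLocalRing.residue _) = (IsLocalRing.residue _).comp g :=
    RingHom.ext fun y => hf y (g y).2
  rw [algebraicIndependent_iff]
  intro p hp
  by_contra hp0
  obtain ⟨c, q, hq, hq0⟩ := exists_rescale_map_residue_ne_zero w hp0
  have hqx : MvPolynomial.eval₂ g x q = 0 := by
    apply v.valuationSubring.subtype_injective
    rw [MvPolynomial.aeval_def] at hp
    calc v.valuationSubring.subtype (MvPolynomial.eval₂ g x q)
        = MvPolynomial.eval₂ ((algebraMap K L).comp w.valuationSubring.subtype)
            (fun i => (x i : L)) q := MvPolynomial.eval₂_comp_left _ _ _ _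
      _ = MvPolynomial.eval₂ (algebraMap K L) (fun i => (x i : L))
            (MvPolynomial.map w.valuationSubring.subtype q) :=
          (MvPolynomial.eval₂_map _ _ _ _).symm
      _ = v.valuationSubring.subtype 0 := by
          rw [hq, MvPolynomial.eval₂_mul, hp, mul_zero, map_zero]
  let := f.toAlgebra
  refine hq0 ((algebraicIndependent_iff.mp hind) _ ?_)
  change MvPolynomial.eval₂ f _ _ = 0
  rw [MvPolynomial.eval₂_map, hfg]
  exact (MvPolynomial.eval₂_comp_left (IsLocalRing.residue _) g x q).symm.trans
    (by rw [hqx, map_zero])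
end

section
/- Let p be a prime number, let N be a finite group, and let P be a finite p-group acting on N by group automorphisms. Then there exists a Sylow p-subgroup Q of N which is invariant under the action of P, i.e., σ(Q) = Q for every automorphism σ of N coming from an element of P. -/
/-- Let `p` be a prime, `N` a finite group, and `P` a finite `p`-group acting on `N` by
group automorphisms (via `φ : P →* MulAut N`).  Then there is a Sylow `p`-subgroup `Q` of
`N` which is invariant under the action of `P`. -/
theorem stmt2 (p : ℕ) (hp : p.Prime) (N : Type*) [Group N] [Finite N]
    (P : Type*) [Group P] [Finite P] (hP : IsPGroup p P) (φ : P →* MulAut N) :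
    ∃ Q : Sylow p N, ∀ σ : P, Subgroup.map (φ σ).toMonoidHom (Q : Subgroup N) = Q := by
  have : Fact p.Prime := ⟨hp⟩
  let _ : MulAction P (Sylow p N) := MulAction.compHom _ φ
  obtain ⟨Q, hQ⟩ := hP.nonempty_fixed_point_of_prime_not_dvd_card (Sylow p N)
    (not_dvd_card_sylow p N)
  exact ⟨Q, fun σ => congrArg Sylow.toSubgroup (hQ σ)⟩
end

section
/- Let d ≥ 1 be an integer and p a prime number. Then there exists a positive integer N such that for every finite subgroup H of GL_d(ℤ), the reduction-mod-p^N homomorphism GL_d(ℤ) → GL_d(ℤ/p^Nℤ) is injective when restricted to H. -/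
theorem exists_one_add_pow_eq {R : Type*} [Ring R] (X : R) (n : ℕ) :
    ∃ C : R, (1 + X) ^ n = 1 + n * X + X ^ 2 * C := by
  induction n with
  | zero => exact ⟨0, by simp⟩
  | succ n ih =>
    obtain ⟨C, hC⟩ := ih
    refine ⟨n + C + C * X, ?_⟩
    have hcomm : (n : R) * X * X = X ^ 2 * n := by
      rw [mul_assoc, ← sq, (Nat.cast_commute n (X ^ 2)).eq]
    have expand : (1 + n * X + X ^ 2 * C) * (1 + X) =
        1 + X + n * X + (n : R) * X * X + X ^ 2 * C + X ^ 2 * (C * X) := by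
      noncomm_ring
    rw [pow_succ, hC, expand, hcomm]
    push_cast
    noncomm_ring

theorem Nat.Prime.pow_succ_dvd_of_pow_two_mul_dvd {p q k : ℕ} (hp : p.Prime) (hq : q.Prime)
    (hk : 2 ≤ k) {x : ℤ} (h : (p : ℤ) ^ (2 * k) ∣ q * x) : (p : ℤ) ^ (k + 1) ∣ x := by
  by_cases hpq : p = q
  · subst hpq
    have hp0 : (p : ℤ) ≠ 0 := by exact_mod_cast hp.ne_zero
    rw [show 2 * k = (2 * k - 1) + 1 by omega, _root_.pow_succ', mul_dvd_mul_iff_left hp0] at h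
    exact (pow_dvd_pow _ (by omega)).trans h
  · have hcop : IsCoprime ((p : ℤ) ^ (2 * k)) (q : ℤ) :=
      (Nat.isCoprime_iff_coprime.mpr ((Nat.coprime_primes hp hq).mpr hpq)).pow_left
    exact (pow_dvd_pow _ (by omega)).trans (hcop.dvd_of_dvd_mul_left h)

section

variable {ι : Type*} [Fintype ι] [DecidableEq ι] {p : ℕ}

theorem Matrix.dvd_apply_of_one_add_pow_eq_one {X : Matrix ι ι ℤ} {q : ℕ} (hp : p.Prime)
    (hq : q.Prime) (hX : (1 + X) ^ q = 1) (h : ∀ i j, (p : ℤ) ^ 2 ∣ X i j) (k : ℕ) (hk : 2 ≤ k) :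
    ∀ i j, (p : ℤ) ^ k ∣ X i j := by
  induction k, hk using Nat.le_induction with
  | base => exact h
  | succ k hk ih =>
    intro i j
    choose A hA using ih
    have hXA : X = (p : ℤ) ^ k • (Matrix.of A) := by
      ext i j
      simp [hA]
    obtain ⟨C, hC⟩ := exists_one_add_pow_eq X q
    have hqX : (q : Matrix ι ι ℤ) * X = -(X ^ 2 * C) := by
      rw [hX, add_assoc, left_eq_add] at hC
      exact eq_neg_of_add_eq_zero_left hC
    refine hp.pow_succ_dvd_of_pow_two_mul_dvd hq hk ⟨-((Matrix.of A) ^ 2 * C) i j, ?_⟩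
    have hij := congr_fun₂ hqX i j
    rw [← nsmul_eq_mul] at hij
    calc (q : ℤ) * X i j = (-(X ^ 2 * C)) i j := by simpa using hij
      _ = _ := by
        rw [hXA, smul_pow, smul_mul_assoc, ← pow_mul, mul_comm k 2]
        simp only [Matrix.neg_apply, Matrix.smul_apply, smul_eq_mul, mul_neg]

theorem Matrix.eq_one_of_pow_prime_eq_one {M : Matrix ι ι ℤ} {q : ℕ} (hp : p.Prime)
    (hq : q.Prime) (hM : M ^ q = 1) (h : ∀ i j, (p : ℤ) ^ 2 ∣ (M - 1) i j) : M = 1 := by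
  have hdvd := Matrix.dvd_apply_of_one_add_pow_eq_one (X := M - 1) hp hq (by simpa using hM) h
  rw [← sub_eq_zero]
  ext i j
  by_contra hne
  obtain ⟨n, hn⟩ := Int.finiteMultiplicity_iff.mpr
    ⟨(Int.natAbs_natCast p).trans_ne hp.ne_one, hne⟩
  exact hn ((pow_dvd_pow _ (by omega)).trans (hdvd (n + 2) (by omega) i j))

theorem Matrix.GeneralLinearGroup.eq_one_of_map_eq_one_of_pow_eq_one (hp : p.Prime) {n : ℕ}
    (hn : n ≠ 0) (g : GL ι ℤ)
    (hg : Matrix.GeneralLinearGroup.map (Int.castRingHom (ZMod (p ^ 2))) g = 1)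
    (hpow : g ^ n = 1) : g = 1 := by
  induction n using induction_on_primes generalizing g with
  | zero => exact absurd rfl hn
  | one => simpa using hpow
  | prime_mul q m hq ih =>
    have hgq : g ^ q = 1 := ih (right_ne_zero_of_mul hn) (g ^ q) (by rw [map_pow, hg, one_pow])
      (by rw [← pow_mul, hpow])
    refine Units.ext (Matrix.eq_one_of_pow_prime_eq_one hp hq
      (by simpa using congr_arg Units.val hgq) fun i j ↦ ?_)
    have hval := congr_arg Units.val hg
    have hij := congr_fun₂ hval i j
    have hcast : (((g : Matrix ι ι ℤ) i j : ℤ) : ZMod (p ^ 2)) =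
        (((1 : Matrix ι ι ℤ) i j : ℤ) : ZMod (p ^ 2)) := by
      simpa [Matrix.one_apply, apply_ite] using hij
    have := (ZMod.intCast_eq_intCast_iff_dvd_sub _ _ _).mp hcast.symm
    simpa using this

end


/-- Let `d ≥ 1` and let `p` be a prime.  Then there is a positive integer `N` such that for
every finite subgroup `H` of `GL d ℤ`, the reduction-mod-`p^N` homomorphism
`GL d ℤ →* GL d (ZMod (p^N))` is injective on `H`. -/
theorem stmt4 (d : ℕ) (hd : 1 ≤ d) (p : ℕ) (hp : p.Prime) :
    ∃ N : ℕ, 0 < N ∧ ∀ H : Subgroup (GL (Fin d) ℤ), Finite H →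
      Set.InjOn (Matrix.GeneralLinearGroup.map (Int.castRingHom (ZMod (p ^ N))))
        (H : Set (GL (Fin d) ℤ)) := by
  refine ⟨2, two_pos, fun H _ g hg h hh hgh ↦ ?_⟩
  obtain ⟨n, hn, hpow⟩ := isOfFinOrder_iff_pow_eq_one.mp
    (isOfFinOrder_of_finite (⟨g⁻¹ * h, H.mul_mem (H.inv_mem hg) hh⟩ : H))
  refine inv_mul_eq_one.mp
    (Matrix.GeneralLinearGroup.eq_one_of_map_eq_one_of_pow_eq_one hp hn.ne' (g⁻¹ * h) ?_
      (by simpa using congr_arg Subtype.val hpow))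
  rw [map_mul, map_inv, hgh, inv_mul_cancel]
end

section
/- Let p be a prime and n a positive integer divisible by p. Let M be the quotient of the free ℤ-module ℤ^n by the submodule generated by the vector (1,1,…,1), equipped with the action of the symmetric group S_n permuting the n coordinates (this action descends to M). Let H ⊆ S_n be the subgroup generated by the n/p pairwise disjoint p-cycles (1 2 … p), (p+1 p+2 … 2p), …, (n−p+1 … n). Then every finite H-invariant subset S ⊆ M that generates a subgroup of finite index prime to p in M has cardinality at least n. -/
/-- The submodule of `ℤ^n` generated by the all-ones vector `(1,…,1)`. -/
def onesSubmodule (n : ℕ) : Submodule ℤ (Fin n → ℤ) :=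
  Submodule.span ℤ {(1 : Fin n → ℤ)}

/-- The quotient `M = ℤ^n ⧸ ℤ·(1,…,1)`. -/
abbrev Mquot (n : ℕ) := (Fin n → ℤ) ⧸ onesSubmodule n

lemma onesSubmodule_le_comap (n : ℕ) (σ : Equiv.Perm (Fin n)) :
    onesSubmodule n ≤ (onesSubmodule n).comap (LinearMap.funLeft ℤ ℤ σ) := by
  rw [onesSubmodule, Submodule.span_le]
  intro x hx
  rw [Set.mem_singleton_iff] at hx
  subst hx
  have h1 : LinearMap.funLeft ℤ ℤ σ 1 = 1 := rfl
  show LinearMap.funLeft ℤ ℤ σ 1 ∈ Submodule.span ℤ {(1 : Fin n → ℤ)}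
  rw [h1]
  exact Submodule.mem_span_singleton_self 1

/-- The coordinate-permutation action of `S_n` on `ℤ^n` descends to the quotient
`M = ℤ^n ⧸ ℤ·(1,…,1)`, since the all-ones vector is fixed (up to sign of the convention,
`σ` acts by precomposition `v ↦ v ∘ σ`). -/
def permQuot (n : ℕ) (σ : Equiv.Perm (Fin n)) : Mquot n →ₗ[ℤ] Mquot n :=
  Submodule.mapQ _ _ (LinearMap.funLeft ℤ ℤ σ) (onesSubmodule_le_comap n σ)

/-- For `p ∣ n` and `j < n/p`, the `p`-cycle `(jp+1  jp+2  …  jp+p)` in `S_n`, i.e. the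
permutation cyclically shifting the `j`-th consecutive block of `p` coordinates and fixing
all other coordinates.  (For `j = 0,…,n/p − 1` these are the disjoint `p`-cycles
`(1 2 … p), (p+1 … 2p), …, (n−p+1 … n)`.) -/
def blockCycle (n p : ℕ) (h : p ∣ n) (j : Fin (n / p)) : Equiv.Perm (Fin n) :=
  Equiv.permCongr (finProdFinEquiv.trans (finCongr (Nat.div_mul_cancel h)))
    ((Equiv.refl (Fin (n / p))).prodShear
      fun a => if a = j then finRotate p else Equiv.refl (Fin p))

/-- The enumeration of the `n` coordinates by blocks of length `p`. -/
def blockEquiv (n p : ℕ) (h : p ∣ n) : Fin (n / p) × Fin p ≃ Fin n :=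
  finProdFinEquiv.trans (finCongr (Nat.div_mul_cancel h))

lemma blockCycle_blockEquiv {n p : ℕ} (h : p ∣ n) (j i : Fin (n / p)) (a : Fin p) :
    blockCycle n p h j (blockEquiv n p h (i, a)) =
      blockEquiv n p h (i, if i = j then finRotate p a else a) := by
  rw [blockCycle, Equiv.permCongr_apply, blockEquiv, Equiv.symm_apply_apply]
  by_cases hij : i = j <;> simp [hij]

lemma finRotate_iterate_self (p : ℕ) (a : Fin p) : (finRotate p)^[p] a = a := by
  have : NeZero p := ⟨by rintro rfl; exact a.elim0⟩
  have key : ∀ k : ℕ, (finRotate p)^[k] a = a + k • (1 : Fin p) := by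
    intro k
    induction k with
    | zero => simp
    | succ k ih => rw [Function.iterate_succ_apply', ih, finRotate_apply, succ_nsmul, add_assoc]
  have hp : p • (1 : Fin p) = 0 := by
    simpa using card_nsmul_eq_zero' (G := Fin p) (x := 1)
  rw [key, hp, add_zero]

lemma eq_of_forall_finRotate_eq {α : Type*} {p : ℕ} (f : Fin p → α)
    (hf : ∀ a, f (finRotate p a) = f a) (a b : Fin p) : f a = f b := by
  obtain _ | q := p
  · exact a.elim0
  · have key : ∀ c, f c = f 0 := by
      intro c
      induction c using Fin.induction with
      | zero => rfl
      | succ i ih => rw [← ih, ← hf i.castSucc, finRotate_apply, Fin.coeSucc_eq_succ]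
    rw [key a, key b]

lemma blockCycle_iterate_self {n p : ℕ} (h : p ∣ n) (j : Fin (n / p)) (x : Fin n) :
    (blockCycle n p h j)^[p] x = x := by
  obtain ⟨⟨i, a⟩, rfl⟩ := (blockEquiv n p h).surjective x
  have key : ∀ k : ℕ, (blockCycle n p h j)^[k] (blockEquiv n p h (i, a)) =
      blockEquiv n p h (i, if i = j then (finRotate p)^[k] a else a) := by
    intro k
    induction k with
    | zero => simp
    | succ k ih =>
      rw [Function.iterate_succ_apply', ih, blockCycle_blockEquiv, Function.iterate_succ_apply']
      split_ifs <;> rfl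
  rw [key, finRotate_iterate_self, ite_self]

lemma permQuot_mk {n : ℕ} (σ : Equiv.Perm (Fin n)) (v : Fin n → ℤ) :
    permQuot n σ (Submodule.Quotient.mk v) = Submodule.Quotient.mk (v ∘ σ) := rfl

lemma permQuot_iterate_mk {n : ℕ} (σ : Equiv.Perm (Fin n)) (v : Fin n → ℤ) (k : ℕ) :
    (permQuot n σ)^[k] (Submodule.Quotient.mk v) = Submodule.Quotient.mk (v ∘ σ^[k]) := by
  induction k with
  | zero => rfl
  | succ k ih =>
    rw [Function.iterate_succ_apply', ih, permQuot_mk, Function.comp_assoc,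
      ← Function.iterate_succ]

/-- The sums of the coordinates over each block, modulo `p`, on `ℤ^n`. -/
def blockSumAux (n p : ℕ) (h : p ∣ n) : (Fin n → ℤ) →ₗ[ℤ] (Fin (n / p) → ZMod p) where
  toFun v j := ∑ a, (v (blockEquiv n p h (j, a)) : ZMod p)
  map_add' v w := by
    ext j
    simp [Finset.sum_add_distrib]
  map_smul' c v := by
    ext j
    simp [Finset.mul_sum]

/-- The sums of the coordinates over each block, modulo `p`, on `ℤ^n ⧸ ℤ·(1,…,1)`. -/
def blockSum (n p : ℕ) (h : p ∣ n) : Mquot n →ₗ[ℤ] (Fin (n / p) → ZMod p) :=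
  (onesSubmodule n).liftQ (blockSumAux n p h) <| by
    rw [onesSubmodule, Submodule.span_singleton_le_iff_mem, LinearMap.mem_ker]
    ext j
    simp [blockSumAux]

lemma blockSum_mk {n p : ℕ} (h : p ∣ n) (v : Fin n → ℤ) (j : Fin (n / p)) :
    blockSum n p h (Submodule.Quotient.mk v) j = ∑ a, (v (blockEquiv n p h (j, a)) : ZMod p) :=
  rfl

lemma blockSum_surjective {n p : ℕ} (hp : p.Prime) (h : p ∣ n) :
    Function.Surjective (blockSum n p h) := by
  intro y
  have : NeZero p := ⟨hp.ne_zero⟩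
  refine ⟨Submodule.Quotient.mk fun x =>
    if ((blockEquiv n p h).symm x).2 = 0 then ((y ((blockEquiv n p h).symm x).1).val : ℤ) else 0,
    ?_⟩
  ext j
  simp [blockSum_mk, apply_ite]

lemma blockSum_permQuot_blockCycle {n p : ℕ} (h : p ∣ n) (j : Fin (n / p)) (x : Mquot n) :
    blockSum n p h (permQuot n (blockCycle n p h j) x) = blockSum n p h x := by
  obtain ⟨v, rfl⟩ := Submodule.Quotient.mk_surjective _ x
  ext i
  rw [permQuot_mk, blockSum_mk, blockSum_mk]
  by_cases hij : i = j
  · simp only [Function.comp_apply, blockCycle_blockEquiv, if_pos hij]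
    exact Equiv.sum_comp (finRotate p) fun a => (v (blockEquiv n p h (i, a)) : ZMod p)
  · simp only [Function.comp_apply, blockCycle_blockEquiv, if_neg hij]

lemma blockSum_eq_zero_of_isFixedPt {n p : ℕ} (hp : p.Prime) (h : p ∣ n) (j : Fin (n / p))
    (x : Mquot n) (hx : Function.IsFixedPt (permQuot n (blockCycle n p h j)) x) :
    blockSum n p h x j = 0 := by
  obtain ⟨v, rfl⟩ := Submodule.Quotient.mk_surjective _ x
  rw [Function.IsFixedPt, permQuot_mk, Submodule.Quotient.eq, onesSubmodule,
    Submodule.mem_span_singleton] at hx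
  obtain ⟨c, hc⟩ := hx
  set f : Fin p → ℤ := fun a => v (blockEquiv n p h (j, a)) with hf
  have hstep : ∀ a, f (finRotate p a) = f a + c := by
    intro a
    have := congrFun hc (blockEquiv n p h (j, a))
    simp only [Pi.smul_apply, Pi.one_apply, smul_eq_mul, mul_one, Pi.sub_apply,
      Function.comp_apply, blockCycle_blockEquiv, if_true] at this
    simp only [hf]
    linarith
  have hsum := Equiv.sum_comp (finRotate p) f
  simp only [hstep, Finset.sum_add_distrib, Finset.sum_const, Finset.card_univ,
    Fintype.card_fin, nsmul_eq_mul, add_eq_left, mul_eq_zero, Nat.cast_eq_zero,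
    hp.ne_zero, false_or] at hsum
  have hconst := eq_of_forall_finRotate_eq f (by simpa [hsum] using hstep)
  rw [blockSum_mk]
  change ∑ a, (f a : ZMod p) = 0
  rw [Finset.sum_congr rfl fun a _ => by rw [hconst a ⟨0, hp.pos⟩]]
  simp

/-- A linear surjection onto an `𝔽_p`-vector space maps a set generating a subgroup of finite
index prime to `p` to a spanning set. -/
lemma span_image_eq_top_of_index_coprime {p : ℕ} [Fact p.Prime] {M V : Type*} [AddCommGroup M]
    [AddCommGroup V] [Module (ZMod p) V] (f : M →ₗ[ℤ] V) (hf : Function.Surjective f)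
    (S : Set M) (hcop : ¬ p ∣ Nat.card (M ⧸ Submodule.span ℤ S)) :
    Submodule.span (ZMod p) (f '' S) = ⊤ := by
  rw [eq_top_iff]
  rintro y -
  obtain ⟨x, rfl⟩ := hf y
  set N := Nat.card (M ⧸ Submodule.span ℤ S) with hN
  have hx : N • x ∈ Submodule.span ℤ S := by
    rw [← Submodule.Quotient.mk_eq_zero, ← Submodule.mkQ_apply, map_nsmul]
    exact card_nsmul_eq_zero'
  have hle : Submodule.span ℤ S ≤
      ((Submodule.span (ZMod p) (f '' S)).restrictScalars ℤ).comap f :=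
    Submodule.span_le.2 fun s hs => Submodule.subset_span (Set.mem_image_of_mem f hs)
  have hNx : (N : ZMod p) • f x ∈ Submodule.span (ZMod p) (f '' S) := by
    rw [Nat.cast_smul_eq_nsmul, ← map_nsmul]
    exact hle hx
  refine (Submodule.smul_mem_iff _ ?_).1 hNx
  rwa [Ne, ZMod.natCast_eq_zero_iff]

/-- A finite set stable under a map, containing a point of prime period `p` that is not fixed,
has at least `p` elements. -/
lemma prime_le_card_of_mapsTo {α : Type*} [DecidableEq α] {p : ℕ} [Fact p.Prime] {f : α → α}
    {s : Finset α} (hs : ∀ y ∈ s, f y ∈ s) {x : α} (hx : x ∈ s)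
    (hper : Function.IsPeriodicPt f p x) (hfix : ¬ Function.IsFixedPt f x) : p ≤ s.card := by
  have hinj := Function.iterate_injOn_Iio_minimalPeriod (f := f) (x := x)
  rw [Function.minimalPeriod_eq_prime hper hfix] at hinj
  have hmem : ∀ k : ℕ, f^[k] x ∈ s := by
    intro k
    induction k with
    | zero => exact hx
    | succ k ih => rw [Function.iterate_succ_apply']; exact hs _ ih
  have := Finset.card_le_card_of_injOn (s := Finset.range p) (fun k => f^[k] x)
    (fun k _ => hmem k) (by simpa using hinj)
  simpa using this

/-- Let `p` be a prime and `n` a positive integer divisible by `p`.  Let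
`M = ℤ^n ⧸ ℤ·(1,…,1)` with the coordinate-permutation action of `S_n`, and let
`H ≤ S_n` be the subgroup generated by the `n/p` disjoint `p`-cycles
`(1 2 … p), (p+1 … 2p), …, (n−p+1 … n)`.  Then every finite `H`-invariant subset
`S ⊆ M` generating a subgroup of finite index prime to `p` in `M` has cardinality at
least `n`. -/
theorem stmt6 (p n : ℕ) (hp : p.Prime) (hn : 0 < n) (hdvd : p ∣ n)
    (H : Subgroup (Equiv.Perm (Fin n)))
    (hH : H = Subgroup.closure {σ | ∃ j : Fin (n / p), σ = blockCycle n p hdvd j})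
    (S : Set (Mquot n)) (hfin : S.Finite)
    (hinv : ∀ σ ∈ H, permQuot n σ '' S = S)
    (hfinidx : Finite (Mquot n ⧸ Submodule.span ℤ S))
    (hcop : ¬ p ∣ Nat.card (Mquot n ⧸ Submodule.span ℤ S)) :
    n ≤ S.ncard := by
  classical
  have : Fact p.Prime := ⟨hp⟩
  set s := blockSum n p hdvd
  have hspan := span_image_eq_top_of_index_coprime s (blockSum_surjective hp hdvd) S hcop
  set T : Finset (Fin (n / p) → ZMod p) := (hfin.toFinset.image s).erase 0 with hT
  have hTspan : Submodule.span (ZMod p) (T : Set (Fin (n / p) → ZMod p)) = ⊤ := by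
    rw [hT, Finset.coe_erase, Finset.coe_image, Set.Finite.coe_toFinset,
      Submodule.span_sdiff_singleton_zero, hspan]
  have hTcard : n / p ≤ T.card := by
    have := finrank_span_finset_le_card (R := ZMod p) T
    rwa [Set.finrank, hTspan, finrank_top, Module.finrank_fin_fun] at this
  have hfiber : ∀ t ∈ T, p ≤ (hfin.toFinset.filter fun x => s x = t).card := by
    intro t ht
    obtain ⟨ht0, htS⟩ := Finset.mem_erase.1 ht
    obtain ⟨x, hxS, rfl⟩ := Finset.mem_image.1 htS
    obtain ⟨j, hj⟩ := Function.ne_iff.1 ht0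
    refine prime_le_card_of_mapsTo (f := permQuot n (blockCycle n p hdvd j)) (x := x) ?_
      (Finset.mem_filter.2 ⟨hxS, rfl⟩) ?_
      fun hfix => hj (blockSum_eq_zero_of_isFixedPt hp hdvd j x hfix)
    · intro y hy
      rw [Finset.mem_filter, Set.Finite.mem_toFinset] at hy ⊢
      refine ⟨?_, (blockSum_permQuot_blockCycle hdvd j y).trans hy.2⟩
      have hmem : blockCycle n p hdvd j ∈ H := hH ▸ Subgroup.subset_closure ⟨j, rfl⟩
      rw [← hinv _ hmem]
      exact Set.mem_image_of_mem _ hy.1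
    · obtain ⟨v, rfl⟩ := Submodule.Quotient.mk_surjective _ x
      rw [Function.IsPeriodicPt, Function.IsFixedPt, permQuot_iterate_mk,
        show (blockCycle n p hdvd j)^[p] = id from funext (blockCycle_iterate_self hdvd j),
        Function.comp_id]
  calc n = p * (n / p) := (Nat.mul_div_cancel' hdvd).symm
    _ ≤ p * T.card := Nat.mul_le_mul_left p hTcard
    _ = ∑ _t ∈ T, p := by rw [Finset.sum_const, smul_eq_mul, mul_comm]
    _ ≤ ∑ t ∈ T, (hfin.toFinset.filter fun x => s x = t).card := Finset.sum_le_sum hfiber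
    _ ≤ hfin.toFinset.card := by
      rw [Finset.sum_card_fiberwise_eq_card_filter]
      exact Finset.card_filter_le _ _
    _ = S.ncard := (Set.ncard_eq_toFinset_card S hfin).symm
end

section
/- Let n ≥ 1 be an integer and let M = ℤ^{2n}. For i = 1,…,n let σ_i be the ℤ-linear automorphism of M interchanging the coordinates 2i−1 and 2i and fixing all other coordinates, and let τ_i be the ℤ-linear automorphism of M negating the coordinates 2i−1 and 2i and fixing all other coordinates. Let H be the subgroup of GL_{2n}(ℤ) generated by σ_1,…,σ_n,τ_1,…,τ_n (an elementary abelian 2-group of order 2^{2n}). Then every finite H-invariant subset S ⊆ M that generates a subgroup of finite odd index in M has cardinality at least 4n. -/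
/-- For `i < n`, the `ℤ`-linear automorphism `σ_i` of `M = ℤ^{2n}` interchanging the
coordinates `2i` and `2i+1` (the `(2i−1)`-st and `2i`-th in 1-based numbering) and fixing
all other coordinates. -/
def sigmaSwap (n : ℕ) (i : Fin n) : (Fin (2 * n) → ℤ) ≃ₗ[ℤ] (Fin (2 * n) → ℤ) :=
  LinearEquiv.funCongrLeft ℤ ℤ
    (Equiv.swap (⟨2 * i.val, by have := i.isLt; omega⟩ : Fin (2 * n))
      (⟨2 * i.val + 1, by have := i.isLt; omega⟩ : Fin (2 * n)))

/-- The `ℤ`-linear endomorphism of `M = ℤ^{2n}` negating the coordinates `2i` and `2i+1`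
and fixing all other coordinates. -/
def tauNegMap (n : ℕ) (i : Fin n) : (Fin (2 * n) → ℤ) →ₗ[ℤ] (Fin (2 * n) → ℤ) where
  toFun v := fun j => if j.val = 2 * i.val ∨ j.val = 2 * i.val + 1 then -v j else v j
  map_add' v w := by
    funext j
    by_cases h : j.val = 2 * i.val ∨ j.val = 2 * i.val + 1 <;> simp [h, neg_add] <;> ring
  map_smul' c v := by
    funext j
    by_cases h : j.val = 2 * i.val ∨ j.val = 2 * i.val + 1 <;> simp [h, mul_neg]

/-- For `i < n`, the `ℤ`-linear automorphism `τ_i` of `M = ℤ^{2n}` negating the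
coordinates `2i` and `2i+1` and fixing all other coordinates. -/
def tauNeg (n : ℕ) (i : Fin n) : (Fin (2 * n) → ℤ) ≃ₗ[ℤ] (Fin (2 * n) → ℤ) :=
  LinearEquiv.ofInvolutive (tauNegMap n i) (by
    intro v
    funext j
    by_cases h : j.val = 2 * i.val ∨ j.val = 2 * i.val + 1 <;> simp [tauNegMap, h])

/-- The `ℤ`-linear map `ℤ^{2n} → 𝔽₂^n` adding up, modulo `2`, the two coordinates of each block;
it is the quotient onto the coinvariants of `ℤ^{2n} ⊗ 𝔽₂` under the block swaps. -/
def blockParity (n : ℕ) : (Fin (2 * n) → ℤ) →ₗ[ℤ] (Fin n → ZMod 2) where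
  toFun v := fun i => ((v ⟨2 * i.val, by have := i.isLt; omega⟩ +
    v ⟨2 * i.val + 1, by have := i.isLt; omega⟩ : ℤ) : ZMod 2)
  map_add' v w := by
    funext i
    simp only [Pi.add_apply]
    push_cast
    ring
  map_smul' c v := by
    funext i
    simp

lemma blockParity_apply {n : ℕ} (v : Fin (2 * n) → ℤ) (i : Fin n) :
    blockParity n v i = ((v ⟨2 * i.val, by have := i.isLt; omega⟩ +
      v ⟨2 * i.val + 1, by have := i.isLt; omega⟩ : ℤ) : ZMod 2) := rfl

lemma sigmaSwap_apply {n : ℕ} (i : Fin n) (v : Fin (2 * n) → ℤ) (j : Fin (2 * n)) :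
    sigmaSwap n i v j = v (Equiv.swap (⟨2 * i.val, by have := i.isLt; omega⟩ : Fin (2 * n))
      (⟨2 * i.val + 1, by have := i.isLt; omega⟩ : Fin (2 * n)) j) := rfl

lemma tauNeg_apply {n : ℕ} (i : Fin n) (v : Fin (2 * n) → ℤ) (j : Fin (2 * n)) :
    tauNeg n i v j = if j.val = 2 * i.val ∨ j.val = 2 * i.val + 1 then -v j else v j := rfl

lemma blockParity_sigmaSwap {n : ℕ} (i : Fin n) (v : Fin (2 * n) → ℤ) :
    blockParity n (sigmaSwap n i v) = blockParity n v := by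
  funext k
  simp only [blockParity_apply, sigmaSwap_apply]
  by_cases h : k = i
  · subst h
    rw [Equiv.swap_apply_left, Equiv.swap_apply_right, add_comm]
  · have h' : k.val ≠ i.val := fun e => h (Fin.ext e)
    rw [Equiv.swap_apply_of_ne_of_ne, Equiv.swap_apply_of_ne_of_ne] <;>
      simp only [ne_eq, Fin.mk.injEq] <;> omega

lemma blockParity_tauNeg {n : ℕ} (i : Fin n) (v : Fin (2 * n) → ℤ) :
    blockParity n (tauNeg n i v) = blockParity n v := by
  funext k
  simp only [blockParity_apply, tauNeg_apply]
  by_cases h : k = i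
  · subst h
    simp [ZMod.neg_eq_self_mod_two]
  · have h' : k.val ≠ i.val := fun e => h (Fin.ext e)
    rw [if_neg (by omega), if_neg (by omega)]

lemma blockParity_surjective (n : ℕ) : Function.Surjective (blockParity n) := by
  intro w
  refine ⟨fun j => if j.val % 2 = 0 then ((w ⟨j.val / 2, by omega⟩).val : ℤ) else 0, ?_⟩
  funext i
  rw [blockParity_apply]
  simp [Nat.add_mod]

/-- A fibre of `blockParity n` over a nonzero vector meets every set stable under the swaps and
block negations either trivially or in at least four elements. -/
lemma four_le_card_fiber {n : ℕ} {T : Finset (Fin (2 * n) → ℤ)}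
    (hσ : ∀ i, ∀ v ∈ T, sigmaSwap n i v ∈ T) (hτ : ∀ i, ∀ v ∈ T, tauNeg n i v ∈ T)
    {v : Fin (2 * n) → ℤ} (hv : v ∈ T) (h0 : blockParity n v ≠ 0) :
    4 ≤ (T.filter fun u => blockParity n u = blockParity n v).card := by
  obtain ⟨i, hi⟩ := Function.ne_iff.mp h0
  have hi' : ¬ (2 : ℤ) ∣ v ⟨2 * i.val, by have := i.isLt; omega⟩ +
      v ⟨2 * i.val + 1, by have := i.isLt; omega⟩ := fun h =>
    hi ((ZMod.intCast_zmod_eq_zero_iff_dvd _ 2).mpr h)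
  have hsub : ({v, sigmaSwap n i v, tauNeg n i v, tauNeg n i (sigmaSwap n i v)} :
      Finset (Fin (2 * n) → ℤ)) ⊆ T.filter fun u => blockParity n u = blockParity n v := by
    intro u hu
    simp only [Finset.mem_insert, Finset.mem_singleton] at hu
    rw [Finset.mem_filter]
    rcases hu with rfl | rfl | rfl | rfl
    · exact ⟨hv, rfl⟩
    · exact ⟨hσ i _ hv, blockParity_sigmaSwap i v⟩
    · exact ⟨hτ i _ hv, blockParity_tauNeg i v⟩
    · exact ⟨hτ i _ (hσ i _ hv), by rw [blockParity_tauNeg, blockParity_sigmaSwap]⟩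
  have hcard : ({v, sigmaSwap n i v, tauNeg n i v, tauNeg n i (sigmaSwap n i v)} :
      Finset (Fin (2 * n) → ℤ)).card = 4 := by
    have key : ∀ {a b : Fin (2 * n) → ℤ},
        a ⟨2 * i.val, by have := i.isLt; omega⟩ ≠ b ⟨2 * i.val, by have := i.isLt; omega⟩ ∨
        a ⟨2 * i.val + 1, by have := i.isLt; omega⟩ ≠
          b ⟨2 * i.val + 1, by have := i.isLt; omega⟩ → a ≠ b := by
      rintro a _ h rfl
      simp at h
    rw [Finset.card_insert_of_notMem, Finset.card_insert_of_notMem, Finset.card_pair]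
    · apply key
      simp [sigmaSwap_apply, tauNeg_apply]
      omega
    · simp only [Finset.mem_insert, Finset.mem_singleton, not_or]
      constructor <;> apply key <;> simp [sigmaSwap_apply, tauNeg_apply] <;> omega
    · simp only [Finset.mem_insert, Finset.mem_singleton, not_or]
      refine ⟨?_, ?_, ?_⟩ <;> apply key <;> simp [sigmaSwap_apply, tauNeg_apply] <;> omega
  exact hcard ▸ Finset.card_le_card hsub

/-- A linear map to an `𝔽₂`-vector space that is surjective maps a subset generating a subgroup of
odd index to a spanning set. -/
lemma span_image_eq_top_of_odd_index {M V : Type*} [AddCommGroup M] [AddCommGroup V]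
    [Module (ZMod 2) V] {f : M →ₗ[ℤ] V} (hf : Function.Surjective f) {S : Set M}
    (hodd : Odd (Nat.card (M ⧸ Submodule.span ℤ S))) :
    Submodule.span (ZMod 2) (f '' S) = ⊤ := by
  rw [eq_top_iff]
  rintro w -
  obtain ⟨m, rfl⟩ := hf w
  obtain ⟨k, hk⟩ := hodd
  have hm : Nat.card (M ⧸ Submodule.span ℤ S) • m ∈ Submodule.span ℤ S := by
    rw [← Submodule.Quotient.mk_eq_zero, Submodule.Quotient.mk_smul]
    exact card_nsmul_eq_zero'
  have hle : Submodule.span ℤ S ≤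
      ((Submodule.span (ZMod 2) (f '' S)).toAddSubgroup.toIntSubmodule).comap f :=
    Submodule.span_le.mpr fun s hs => Submodule.subset_span ⟨s, hs, rfl⟩
  have h2 : f (Nat.card (M ⧸ Submodule.span ℤ S) • m) ∈ Submodule.span (ZMod 2) (f '' S) :=
    hle hm
  have h3 : (Nat.card (M ⧸ Submodule.span ℤ S) : ZMod 2) = 1 :=
    (ZMod.natCast_eq_one_iff_odd).mpr ⟨k, hk⟩
  rwa [map_nsmul, ← Nat.cast_smul_eq_nsmul (ZMod 2), h3, one_smul] at h2

/-- Let `n ≥ 1` and `M = ℤ^{2n}`.  Let `H` be the subgroup of `GL_{2n}(ℤ)` (identified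
with the group of `ℤ`-linear automorphisms of `M`) generated by
`σ_1,…,σ_n, τ_1,…,τ_n`, where `σ_i` interchanges coordinates `2i−1, 2i` and `τ_i`
negates coordinates `2i−1, 2i` (an elementary abelian `2`-group of order `2^{2n}`).
Then every finite `H`-invariant subset `S ⊆ M` generating a subgroup of finite odd
index in `M` has cardinality at least `4n`. -/
theorem stmt7 (n : ℕ) (hn : 1 ≤ n)
    (H : Subgroup ((Fin (2 * n) → ℤ) ≃ₗ[ℤ] (Fin (2 * n) → ℤ)))
    (hH : H = Subgroup.closure
      {e | ∃ i : Fin n, e = sigmaSwap n i ∨ e = tauNeg n i})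
    (S : Set (Fin (2 * n) → ℤ)) (hfin : S.Finite)
    (hinv : ∀ g ∈ H, (⇑g : (Fin (2 * n) → ℤ) → (Fin (2 * n) → ℤ)) '' S = S)
    (hfinidx : Finite ((Fin (2 * n) → ℤ) ⧸ Submodule.span ℤ S))
    (hodd : Odd (Nat.card ((Fin (2 * n) → ℤ) ⧸ Submodule.span ℤ S))) :
    4 * n ≤ S.ncard := by
  classical
  have hS : ∀ g ∈ H, ∀ v ∈ S, g v ∈ S := fun g hg v hv => by
    rw [← hinv g hg]
    exact ⟨v, hv, rfl⟩
  have hσ : ∀ i, ∀ v ∈ hfin.toFinset, sigmaSwap n i v ∈ hfin.toFinset := fun i v hv =>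
    hfin.mem_toFinset.mpr (hS _ (hH ▸ Subgroup.subset_closure ⟨i, Or.inl rfl⟩) v
      (hfin.mem_toFinset.mp hv))
  have hτ : ∀ i, ∀ v ∈ hfin.toFinset, tauNeg n i v ∈ hfin.toFinset := fun i v hv =>
    hfin.mem_toFinset.mpr (hS _ (hH ▸ Subgroup.subset_closure ⟨i, Or.inr rfl⟩) v
      (hfin.mem_toFinset.mp hv))
  set W := (hfin.toFinset.image (blockParity n)).erase 0 with hW
  have hspan : Submodule.span (ZMod 2) (W : Set (Fin n → ZMod 2)) = ⊤ := by
    rw [hW, Finset.coe_erase, Finset.coe_image, hfin.coe_toFinset, Submodule.span_sdiff_singleton_zero]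
    exact span_image_eq_top_of_odd_index (blockParity_surjective n) hodd
  have hn_le : n ≤ W.card := by
    have h := finrank_span_finset_le_card (R := ZMod 2) W
    rwa [Set.finrank, hspan, finrank_top, Module.finrank_fin_fun] at h
  have hfib : ∀ w ∈ W, 4 ≤ (hfin.toFinset.filter fun u => blockParity n u = w).card := by
    intro w hw
    obtain ⟨hw0, hw⟩ := Finset.mem_erase.mp hw
    obtain ⟨v, hv, rfl⟩ := Finset.mem_image.mp hw
    exact four_le_card_fiber hσ hτ hv hw0
  calc 4 * n ≤ W.card * 4 := by omega
    _ ≤ ∑ w ∈ W, (hfin.toFinset.filter fun u => blockParity n u = w).card :=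
      Finset.card_nsmul_le_sum W _ 4 hfib
    _ ≤ hfin.toFinset.card := by
      rw [Finset.sum_card_fiberwise_eq_card_filter]
      exact Finset.card_filter_le _ _
    _ = S.ncard := (Set.ncard_eq_toFinset_card S hfin).symm
end
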